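/- Let θ ∈ [0, 2π], let Ω ⊂ ℝ³ be open, and let f = f₀ + f⃗ ∈ C¹(Ω, ℍ(ℂ)) with scalar part f₀ and vector part f⃗. Then f satisfies both ψ^θD[f] = 0 and D^{ψ^θ}[f] = 0 on Ω if and only if ψ^θgrad[f₀](x) := Σₖ₌₁³ (∂f₀/∂xₖ)(x) ψᵏ = 0 for all x ∈ Ω and the vector part f⃗ satisfies both ψ^θD[f⃗] = 0 and D^{ψ^θ}[f⃗] = 0 on Ω (i.e. f⃗ is a ψ^θ-Laplacian vector field). -/

import Mathlib

noncomputable section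

/-- `ℝ³` as Euclidean space. -/
abbrev E3 : Type := EuclideanSpace ℝ (Fin 3)

/-- The structural set `ψ^θ = {𝐢, 𝐢e^{𝐢θ}𝐣, e^{𝐢θ}𝐣}`:
`ψ¹ = 𝐢`, `ψ² = -sin θ·𝐣 + cos θ·𝐤`, `ψ³ = cos θ·𝐣 + sin θ·𝐤`. -/
def psiTheta (θ : ℝ) : Fin 3 → Quaternion ℝ :=
  ![⟨0, 1, 0, 0⟩, ⟨0, 0, -Real.sin θ, Real.cos θ⟩, ⟨0, 0, Real.cos θ, Real.sin θ⟩]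

/-- Embedding of the real quaternions into the complex quaternions. -/
def toQC (a : Quaternion ℝ) : Quaternion ℂ :=
  ⟨(a.re : ℂ), (a.imI : ℂ), (a.imJ : ℂ), (a.imK : ℂ)⟩

/-- Partial derivative `∂g/∂xₖ` of a complex-valued function on `ℝ³`. -/
def pdC (k : Fin 3) (g : E3 → ℂ) (x : E3) : ℂ :=
  fderiv ℝ g x (EuclideanSpace.single k 1)

/-- Componentwise partial derivative `∂f/∂xₖ` of a complex-quaternion-valued function. -/
def pdQ (k : Fin 3) (f : E3 → Quaternion ℂ) (x : E3) : Quaternion ℂ :=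
  ⟨pdC k (fun y => (f y).re) x, pdC k (fun y => (f y).imI) x,
   pdC k (fun y => (f y).imJ) x, pdC k (fun y => (f y).imK) x⟩

/-- The operator `ψ^θD[f] = Σₖ ψᵏ ∂f/∂xₖ`. -/
def DL (ψ : Fin 3 → Quaternion ℝ) (f : E3 → Quaternion ℂ) (x : E3) : Quaternion ℂ :=
  ∑ k : Fin 3, toQC (ψ k) * pdQ k f x

/-- The right operator `D^{ψ^θ}[f] = Σₖ (∂f/∂xₖ) ψᵏ`. -/
def DR (ψ : Fin 3 → Quaternion ℝ) (f : E3 → Quaternion ℂ) (x : E3) : Quaternion ℂ :=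
  ∑ k : Fin 3, pdQ k f x * toQC (ψ k)

/-- `f` is `C¹` on `s` (componentwise). -/
def QCContDiffOn (f : E3 → Quaternion ℂ) (s : Set E3) : Prop :=
  ContDiffOn ℝ 1 (fun x => (f x).re) s ∧ ContDiffOn ℝ 1 (fun x => (f x).imI) s ∧
  ContDiffOn ℝ 1 (fun x => (f x).imJ) s ∧ ContDiffOn ℝ 1 (fun x => (f x).imK) s

/-- The vector part `Vec(f) = f₁𝐢 + f₂𝐣 + f₃𝐤` of a complex-quaternion-valued function. -/
def vecPart (f : E3 → Quaternion ℂ) : E3 → Quaternion ℂ :=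
  fun y => ⟨0, (f y).imI, (f y).imJ, (f y).imK⟩

lemma pdQ_vecPart (k : Fin 3) (f : E3 → Quaternion ℂ) (x : E3) :
    pdQ k (vecPart f) x = (pdQ k f x).im := by
  simp only [pdQ, vecPart, pdC, fderiv_fun_const]
  rfl

lemma psiTheta_re (θ : ℝ) (k : Fin 3) : (psiTheta θ k).re = 0 := by
  fin_cases k <;> rfl

section Algebra

variable {R ι : Type*} [CommRing R] {p : ι → Quaternion R}

lemma star_sum_smul_of_re_eq_zero (s : Finset ι) (hp : ∀ k, (p k).re = 0) (c : ι → R) :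
    star (∑ k ∈ s, c k • p k) = -∑ k ∈ s, c k • p k := by
  rw [star_sum, ← Finset.sum_neg_distrib]
  refine Finset.sum_congr rfl fun k _ => ?_
  ext <;> simp [hp]

lemma star_sum_mul_im_of_re_eq_zero (s : Finset ι) (hp : ∀ k, (p k).re = 0)
    (w : ι → Quaternion R) :
    star (∑ k ∈ s, p k * (w k).im) = ∑ k ∈ s, (w k).im * p k := by
  have hstar (k) : star (p k) = -p k := by ext <;> simp [hp]
  simp [star_sum, hstar]

/-- Left and right multiplication by purely vectorial quaternions both annihilate a family
in the sense of sums iff they do so on its scalar and vector parts separately. -/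
lemma sum_mul_eq_zero_and_iff [NoZeroDivisors R] [NeZero (2 : R)] (s : Finset ι)
    (hp : ∀ k, (p k).re = 0) (w : ι → Quaternion R) :
    (∑ k ∈ s, p k * w k = 0 ∧ ∑ k ∈ s, w k * p k = 0) ↔
      (∑ k ∈ s, (w k).re • p k = 0 ∧ ∑ k ∈ s, p k * (w k).im = 0 ∧
        ∑ k ∈ s, (w k).im * p k = 0) := by
  have hleft : ∑ k ∈ s, p k * w k = ∑ k ∈ s, (w k).re • p k + ∑ k ∈ s, p k * (w k).im := by
    rw [← Finset.sum_add_distrib]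
    refine Finset.sum_congr rfl fun k _ => ?_
    rw [← Quaternion.mul_coe_eq_smul, ← mul_add, Quaternion.re_add_im]
  have hright : ∑ k ∈ s, w k * p k = ∑ k ∈ s, (w k).re • p k + ∑ k ∈ s, (w k).im * p k := by
    rw [← Finset.sum_add_distrib]
    refine Finset.sum_congr rfl fun k _ => ?_
    rw [← Quaternion.coe_mul_eq_smul, ← add_mul, Quaternion.re_add_im]
  rw [hleft, hright]
  constructor
  · rintro ⟨hL, hR⟩
    have hgrad : ∑ k ∈ s, (w k).re • p k = 0 := by
      have hstar := congrArg star hL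
      rw [star_add, star_sum_smul_of_re_eq_zero s hp, star_sum_mul_im_of_re_eq_zero s hp,
        star_zero, neg_add_eq_zero] at hstar
      rw [← hstar, ← two_smul R] at hR
      ext
      all_goals
        refine (mul_eq_zero.mp ?_).resolve_left (two_ne_zero (α := R))
      · exact congrArg (fun q : Quaternion R => q.re) hR
      · exact congrArg (fun q : Quaternion R => q.imI) hR
      · exact congrArg (fun q : Quaternion R => q.imJ) hR
      · exact congrArg (fun q : Quaternion R => q.imK) hR
    rw [hgrad, zero_add] at hL hR
    exact ⟨hgrad, hL, hR⟩
  · rintro ⟨hgrad, hL, hR⟩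
    simp [hgrad, hL, hR]

end Algebra

/-- a `C¹` function `f = f₀ + f⃗ : Ω → ℍ(ℂ)` on an open set `Ω ⊂ ℝ³`
satisfies `ψ^θD[f] = 0` and `D^{ψ^θ}[f] = 0` on `Ω` iff
`ψ^θgrad[f₀] = Σₖ (∂f₀/∂xₖ)ψᵏ = 0` on `Ω` and the vector part `f⃗` satisfies
`ψ^θD[f⃗] = 0` and `D^{ψ^θ}[f⃗] = 0` on `Ω` (i.e. `f⃗` is a `ψ^θ`-Laplacian vector field). -/
theorem stmt5 (θ : ℝ) (hθ : θ ∈ Set.Icc (0 : ℝ) (2 * Real.pi))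
    (Ω : Set E3) (hΩ : IsOpen Ω) (f : E3 → Quaternion ℂ) (hf : QCContDiffOn f Ω) :
    ((∀ x ∈ Ω, DL (psiTheta θ) f x = 0) ∧ (∀ x ∈ Ω, DR (psiTheta θ) f x = 0)) ↔
    ((∀ x ∈ Ω, ∑ k : Fin 3,
        pdC k (fun y => (f y).re) x • toQC (psiTheta θ k) = 0) ∧
     (∀ x ∈ Ω, DL (psiTheta θ) (vecPart f) x = 0) ∧
     (∀ x ∈ Ω, DR (psiTheta θ) (vecPart f) x = 0)) := by
  have pointwise (x : E3) :
      (DL (psiTheta θ) f x = 0 ∧ DR (psiTheta θ) f x = 0) ↔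
      (∑ k : Fin 3, pdC k (fun y => (f y).re) x • toQC (psiTheta θ k) = 0 ∧
        DL (psiTheta θ) (vecPart f) x = 0 ∧ DR (psiTheta θ) (vecPart f) x = 0) := by
    simp only [DL, DR, pdQ_vecPart]
    exact sum_mul_eq_zero_and_iff Finset.univ
      (fun k => congrArg Complex.ofReal (psiTheta_re θ k)) (fun k => pdQ k f x)
  simp only [← forall_and, pointwise]

end
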